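/- arXiv:2505.11998 — 2 statements merged into one kernel-verified Lean document; each statement's English description precedes it below -/
import Mathlib

section
/- Eckart–Young–Mirsky theorem (Frobenius norm version). Let W be a real m×n matrix admitting a singular value decomposition W = Σ_{i=1}^{r} σ_i u_i v_iᵀ, where r = min(m,n), (u_1,…,u_r) is an orthonormal family in ℝ^m, (v_1,…,v_r) is an orthonormal family in ℝ^n, and σ_1 ≥ σ_2 ≥ … ≥ σ_r ≥ 0. For k ∈ {1,…,r}, let W_k = Σ_{i=1}^{k} σ_i u_i v_iᵀ be the sum truncated after k terms. Then for every real m×n matrix M with rank at most k, ‖W − W_k‖_F ≤ ‖W − M‖_F, where ‖·‖_F denotes the Frobenius norm. -/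
open Matrix BigOperators Finset

/-- Pythagoras for a linear combination of vectors that are orthonormal for the dot product. -/
theorem sum_sq_linearCombination_of_orthonormal {ι β : Type*} [DecidableEq ι] [Fintype β]
    {v : ι → β → ℝ} (hv : ∀ i j, (∑ b, v i b * v j b) = if i = j then (1 : ℝ) else 0)
    (s : Finset ι) (c : ι → ℝ) :
    ∑ b, (∑ i ∈ s, c i * v i b) ^ 2 = ∑ i ∈ s, c i ^ 2 := by
  calc ∑ b, (∑ i ∈ s, c i * v i b) ^ 2
      = ∑ b, ∑ i ∈ s, ∑ j ∈ s, c i * c j * (v i b * v j b) := by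
        refine Finset.sum_congr rfl fun b _ => ?_
        rw [sq, Finset.sum_mul_sum]
        exact Finset.sum_congr rfl fun i _ => Finset.sum_congr rfl fun j _ => by ring
    _ = ∑ i ∈ s, ∑ j ∈ s, c i * c j * ∑ b, v i b * v j b := by
        rw [Finset.sum_comm]
        refine Finset.sum_congr rfl fun i _ => ?_
        rw [Finset.sum_comm]
        exact Finset.sum_congr rfl fun j _ => (Finset.mul_sum _ _ _).symm
    _ = ∑ i ∈ s, c i ^ 2 := by
        refine Finset.sum_congr rfl fun i hi => ?_
        simp [hv, hi, sq]

theorem sum_sq_sum_smul_vecMulVec {ι α β : Type*} [DecidableEq ι] [Fintype α] [Fintype β]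
    {u : ι → α → ℝ} {v : ι → β → ℝ}
    (hu : ∀ i j, (∑ a, u i a * u j a) = if i = j then (1 : ℝ) else 0)
    (hv : ∀ i j, (∑ b, v i b * v j b) = if i = j then (1 : ℝ) else 0)
    (s : Finset ι) (σ : ι → ℝ) :
    ∑ a, ∑ b, ((∑ i ∈ s, σ i • Matrix.vecMulVec (u i) (v i)) a b) ^ 2 = ∑ i ∈ s, σ i ^ 2 := by
  have h (a : α) : ∑ b, ((∑ i ∈ s, σ i • Matrix.vecMulVec (u i) (v i)) a b) ^ 2
      = ∑ i ∈ s, (σ i * u i a) ^ 2 := by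
    rw [← sum_sq_linearCombination_of_orthonormal hv]
    simp [Matrix.sum_apply, Matrix.vecMulVec_apply, mul_assoc]
  simp_rw [h]
  rw [Finset.sum_comm]
  refine Finset.sum_congr rfl fun i _ => ?_
  have := hu i i
  simp only [if_true] at this
  simp_rw [mul_pow, ← Finset.mul_sum, sq (u i _), this, mul_one]

/-- Bessel's inequality for the dot product. -/
theorem sum_sq_dotProduct_le_of_orthonormal {ι α : Type*} [DecidableEq ι] [Fintype ι] [Fintype α]
    {e : ι → α → ℝ} (he : ∀ i j, (∑ a, e i a * e j a) = if i = j then (1 : ℝ) else 0)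
    (x : α → ℝ) : ∑ i, (∑ a, x a * e i a) ^ 2 ≤ ∑ a, x a ^ 2 := by
  have h := sum_sq_linearCombination_of_orthonormal he univ (fun i => ∑ a, x a * e i a)
  have h2 : ∑ a, x a * ∑ i, (∑ a', x a' * e i a') * e i a = ∑ i, (∑ a, x a * e i a) ^ 2 := by
    simp_rw [Finset.mul_sum]
    rw [Finset.sum_comm]
    refine Finset.sum_congr rfl fun i _ => ?_
    rw [sq, Finset.mul_sum]
    exact Finset.sum_congr rfl fun a _ => by ring
  have h3 : 0 ≤ ∑ a, (x a - ∑ i, (∑ a', x a' * e i a') * e i a) ^ 2 :=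
    Finset.sum_nonneg fun a _ => sq_nonneg _
  simp_rw [sub_sq, Finset.sum_add_distrib, Finset.sum_sub_distrib, mul_assoc,
    ← Finset.mul_sum] at h3
  linarith

/-- Subtracting a combination of orthonormal vectors removes at most the Fourier coefficients. -/
theorem sum_sq_sub_sum_sq_dotProduct_le {ι α : Type*} [DecidableEq ι] [Fintype ι] [Fintype α]
    {e : ι → α → ℝ} (he : ∀ i j, (∑ a, e i a * e j a) = if i = j then (1 : ℝ) else 0)
    (x : α → ℝ) (c : ι → ℝ) :
    ∑ a, x a ^ 2 - ∑ i, (∑ a, x a * e i a) ^ 2 ≤ ∑ a, (x a - ∑ i, c i * e i a) ^ 2 := by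
  have h := sum_sq_linearCombination_of_orthonormal he univ c
  have h2 : ∑ a, x a * ∑ i, c i * e i a = ∑ i, c i * ∑ a, x a * e i a := by
    simp_rw [Finset.mul_sum]
    rw [Finset.sum_comm]
    exact Finset.sum_congr rfl fun i _ => Finset.sum_congr rfl fun a _ => by ring
  have h3 : 0 ≤ ∑ i, (c i - ∑ a, x a * e i a) ^ 2 := Finset.sum_nonneg fun i _ => sq_nonneg _
  simp_rw [sub_sq, Finset.sum_add_distrib, Finset.sum_sub_distrib, mul_assoc,
    ← Finset.mul_sum] at h3 ⊢
  linarith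

/-- The columns of a matrix are combinations of `M.rank` orthonormal vectors. -/
theorem exists_orthonormal_factorization {m n : ℕ} (M : Matrix (Fin m) (Fin n) ℝ) :
    ∃ (e : Fin M.rank → Fin m → ℝ) (c : Fin n → Fin M.rank → ℝ),
      (∀ i j, (∑ a, e i a * e j a) = if i = j then (1 : ℝ) else 0) ∧
      ∀ a b, M a b = ∑ i, c b i * e i a := by
  have hrank : Module.finrank ℝ (LinearMap.range (Matrix.toEuclideanLin M)) = M.rank := by
    rw [Matrix.toEuclideanLin, Matrix.toLpLin_eq_toLin]
    exact (Matrix.rank_eq_finrank_range_toLin M _ _).symm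
  let B := (stdOrthonormalBasis ℝ (LinearMap.range (Matrix.toEuclideanLin M))).reindex
    (finCongr hrank)
  let y (b : Fin n) : LinearMap.range (Matrix.toEuclideanLin M) :=
    ⟨Matrix.toEuclideanLin M (EuclideanSpace.single b 1), LinearMap.mem_range_self _ _⟩
  refine ⟨fun i a => (B i : EuclideanSpace ℝ (Fin m)) a, fun b i => B.repr (y b) i, ?_, ?_⟩
  · intro i j
    rw [← orthonormal_iff_ite.mp B.orthonormal i j, Submodule.coe_inner, PiLp.inner_apply]
    exact Finset.sum_congr rfl fun a _ => mul_comm _ _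
  · intro a b
    have h := congrArg (fun z : LinearMap.range (Matrix.toEuclideanLin M) =>
      (z : EuclideanSpace ℝ (Fin m)) a) (B.sum_repr (y b))
    have hy : (y b : EuclideanSpace ℝ (Fin m)) a = M a b := by
      simp [y, Matrix.toEuclideanLin, Matrix.toLpLin]
    rw [← hy, ← h]
    simp

/-- A sum of antitone nonnegative weights against coefficients in `[0, 1]` of total mass at most `k`
is at most the sum of the first `k` weights. -/
theorem sum_mul_le_sum_filter_lt {r k : ℕ} (hk1 : 1 ≤ k) (hk2 : k ≤ r) {τ p : Fin r → ℝ}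
    (hτ : ∀ i, 0 ≤ τ i) (hτ_anti : Antitone τ) (hp0 : ∀ i, 0 ≤ p i) (hp1 : ∀ i, p i ≤ 1)
    (hp : ∑ i, p i ≤ k) :
    ∑ i, τ i * p i ≤ ∑ i ∈ univ.filter (fun i : Fin r => (i : ℕ) < k), τ i := by
  have hcard : ∑ i : Fin r, (if (i : ℕ) < k then (1 : ℝ) else 0) = k := by
    rw [Finset.sum_boole, Fin.card_filter_val_lt, min_eq_right hk2]
  let l : Fin r := ⟨k - 1, by omega⟩
  have hpt (i : Fin r) : τ i * p i - (if (i : ℕ) < k then τ i else 0)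
      ≤ τ l * (p i - if (i : ℕ) < k then 1 else 0) := by
    split_ifs with h
    · have : τ l ≤ τ i := hτ_anti (Fin.le_def.mpr (by simp only [l]; omega))
      nlinarith [hp1 i]
    · have : τ i ≤ τ l := hτ_anti (Fin.le_def.mpr (by simp only [l]; omega))
      nlinarith [hp0 i]
  have hsum := Finset.sum_le_sum fun i (_ : i ∈ univ) => hpt i
  rw [← Finset.mul_sum, Finset.sum_sub_distrib, Finset.sum_sub_distrib, hcard,
    ← Finset.sum_filter] at hsum
  nlinarith [hτ l]

/-- Eckart–Young–Mirsky theorem, Frobenius norm version. -/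
theorem eckart_young_mirsky_frobenius
    {m n : ℕ} (W : Matrix (Fin m) (Fin n) ℝ)
    (σ : Fin (min m n) → ℝ)
    (u : Fin (min m n) → Fin m → ℝ) (v : Fin (min m n) → Fin n → ℝ)
    (hu : ∀ i j, (∑ a, u i a * u j a) = if i = j then (1 : ℝ) else 0)
    (hv : ∀ i j, (∑ b, v i b * v j b) = if i = j then (1 : ℝ) else 0)
    (hσ_nonneg : ∀ i, 0 ≤ σ i)
    (hσ_mono : ∀ i j : Fin (min m n), i ≤ j → σ j ≤ σ i)
    (hW : W = ∑ i, σ i • Matrix.vecMulVec (u i) (v i))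
    (k : ℕ) (hk1 : 1 ≤ k) (hk2 : k ≤ min m n)
    (Wk : Matrix (Fin m) (Fin n) ℝ)
    (hWk : Wk = ∑ i ∈ Finset.univ.filter (fun i : Fin (min m n) => (i : ℕ) < k),
        σ i • Matrix.vecMulVec (u i) (v i))
    (M : Matrix (Fin m) (Fin n) ℝ) (hM : M.rank ≤ k) :
    Real.sqrt (∑ a, ∑ b, ((W - Wk) a b) ^ 2) ≤
      Real.sqrt (∑ a, ∑ b, ((W - M) a b) ^ 2) := by
  obtain ⟨e, c, he, hMe⟩ := exists_orthonormal_factorization M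
  have hres : W - Wk = ∑ i ∈ univ.filter (fun i : Fin (min m n) => ¬ (i : ℕ) < k),
      σ i • Matrix.vecMulVec (u i) (v i) := by
    rw [hW, hWk, sub_eq_iff_eq_add', Finset.sum_filter_add_sum_filter_not]
  have hsplit := Finset.sum_filter_add_sum_filter_not univ
    (fun i : Fin (min m n) => (i : ℕ) < k) (fun i => σ i ^ 2)
  have hnorm : ∑ a, ∑ b, W a b ^ 2 = ∑ i, σ i ^ 2 := by
    rw [hW]
    exact sum_sq_sum_smul_vecMulVec hu hv univ σ
  have hproj (j : Fin M.rank) :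
      ∑ b, (∑ a, W a b * e j a) ^ 2 = ∑ i, σ i ^ 2 * (∑ a, u i a * e j a) ^ 2 := by
    simp_rw [← mul_pow]
    rw [← sum_sq_linearCombination_of_orthonormal hv]
    refine Finset.sum_congr rfl fun b _ => congrArg (· ^ 2) ?_
    simp only [hW, Matrix.sum_apply, Matrix.smul_apply, Matrix.vecMulVec_apply, smul_eq_mul,
      Finset.sum_mul, Finset.mul_sum]
    rw [Finset.sum_comm]
    exact Finset.sum_congr rfl fun i _ => Finset.sum_congr rfl fun a _ => by ring
  have hlow : ∑ a, ∑ b, W a b ^ 2 - ∑ j, ∑ b, (∑ a, W a b * e j a) ^ 2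
      ≤ ∑ a, ∑ b, ((W - M) a b) ^ 2 := by
    rw [Finset.sum_comm, Finset.sum_comm (s := (univ : Finset (Fin M.rank))),
      ← Finset.sum_sub_distrib, Finset.sum_comm (f := fun a b => ((W - M) a b) ^ 2)]
    refine Finset.sum_le_sum fun b _ => ?_
    simpa only [Matrix.sub_apply, hMe] using
      sum_sq_sub_sum_sq_dotProduct_le he (fun a => W a b) (c b)
  have hcaptured : ∑ j, ∑ b, (∑ a, W a b * e j a) ^ 2
      ≤ ∑ i ∈ univ.filter (fun i : Fin (min m n) => (i : ℕ) < k), σ i ^ 2 := by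
    simp_rw [hproj]
    rw [Finset.sum_comm]
    simp_rw [← Finset.mul_sum]
    refine sum_mul_le_sum_filter_lt hk1 hk2 (fun i => sq_nonneg _)
      (fun i j hij => pow_le_pow_left₀ (hσ_nonneg j) (hσ_mono i j hij) 2)
      (fun i => Finset.sum_nonneg fun j _ => sq_nonneg _) (fun i => ?_) ?_
    · refine (sum_sq_dotProduct_le_of_orthonormal he (u i)).trans_eq ?_
      simpa [sq] using hu i i
    · rw [Finset.sum_comm]
      calc ∑ j, ∑ i, (∑ a, u i a * e j a) ^ 2 ≤ ∑ _j : Fin M.rank, (1 : ℝ) := by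
            refine Finset.sum_le_sum fun j _ => ?_
            simp_rw [mul_comm (u _ _)]
            refine (sum_sq_dotProduct_le_of_orthonormal hu (e j)).trans_eq ?_
            simpa [sq] using he j j
        _ ≤ k := by simpa using hM
  refine Real.sqrt_le_sqrt ?_
  rw [hres, sum_sq_sum_smul_vecMulVec hu hv]
  linarith
end

section
/- Eckart–Young–Mirsky theorem (spectral norm version). Let W be a real m×n matrix admitting a singular value decomposition W = Σ_{i=1}^{r} σ_i u_i v_iᵀ, where r = min(m,n), (u_1,…,u_r) is an orthonormal family in ℝ^m, (v_1,…,v_r) is an orthonormal family in ℝ^n, and σ_1 ≥ σ_2 ≥ … ≥ σ_r ≥ 0. For k ∈ {1,…,r}, let W_k = Σ_{i=1}^{k} σ_i u_i v_iᵀ. Then for every real m×n matrix M with rank at most k, ‖W − W_k‖ ≤ ‖W − M‖, where ‖·‖ denotes the spectral norm, i.e. the operator norm of the associated linear map from ℝ^n with the Euclidean (ℓ²) norm to ℝ^m with the Euclidean (ℓ²) norm. -/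
open Matrix BigOperators Finset

/-- The spectral norm of a real matrix: the operator norm of the induced linear map
between Euclidean spaces. -/
noncomputable def spectralNorm' {m n : ℕ} (A : Matrix (Fin m) (Fin n) ℝ) : ℝ :=
  ‖LinearMap.toContinuousLinearMap (Matrix.toEuclideanLin A)‖

open scoped RealInnerProductSpace

/-- The squared norm of a combination of orthonormal vectors is the sum of the squared
coefficients. -/
lemma Orthonormal.norm_sq_sum_smul {ι E : Type*} [NormedAddCommGroup E] [InnerProductSpace ℝ E]
    {u : ι → E} (hu : Orthonormal ℝ u) (a : ι → ℝ) (s : Finset ι) :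
    ‖∑ i ∈ s, a i • u i‖ ^ 2 = ∑ i ∈ s, a i ^ 2 := by
  rw [← real_inner_self_eq_norm_sq, hu.inner_sum]
  simp [sq]

/-- A finite diagonal operator between orthonormal families with weights in `[0, c]` is
bounded by `c`. -/
lemma Orthonormal.norm_sum_smul_inner_le {ι E F : Type*}
    [NormedAddCommGroup E] [InnerProductSpace ℝ E]
    [NormedAddCommGroup F] [InnerProductSpace ℝ F]
    {u : ι → F} {v : ι → E} (hu : Orthonormal ℝ u) (hv : Orthonormal ℝ v)
    (s : Finset ι) (σ : ι → ℝ) {c : ℝ} (hc : 0 ≤ c) (h0 : ∀ i ∈ s, 0 ≤ σ i)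
    (hσ : ∀ i ∈ s, σ i ≤ c) (x : E) :
    ‖∑ i ∈ s, (σ i * ⟪v i, x⟫) • u i‖ ≤ c * ‖x‖ := by
  refine le_of_sq_le_sq ?_ (by positivity)
  rw [hu.norm_sq_sum_smul]
  calc ∑ i ∈ s, (σ i * ⟪v i, x⟫) ^ 2
      ≤ ∑ i ∈ s, c ^ 2 * ‖⟪v i, x⟫‖ ^ 2 := by
        refine Finset.sum_le_sum fun i hi => ?_
        rw [mul_pow, Real.norm_eq_abs, sq_abs]
        gcongr
        · exact h0 i hi
        · exact hσ i hi
    _ = c ^ 2 * ∑ i ∈ s, ‖⟪v i, x⟫‖ ^ 2 := by rw [Finset.mul_sum]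
    _ ≤ c ^ 2 * ‖x‖ ^ 2 := by
        gcongr
        exact hv.sum_inner_products_le x
    _ = (c * ‖x‖) ^ 2 := by ring

/-- On combinations of those `v i` whose weights are at least `c`, a diagonal operator between
orthonormal families expands norms by a factor of at least `c`. -/
lemma Orthonormal.mul_norm_le_norm_sum_smul_inner {ι E F : Type*} [Fintype ι]
    [NormedAddCommGroup E] [InnerProductSpace ℝ E]
    [NormedAddCommGroup F] [InnerProductSpace ℝ F]
    {u : ι → F} {v : ι → E} (hu : Orthonormal ℝ u) (hv : Orthonormal ℝ v)
    (t : Finset ι) (σ : ι → ℝ) {c : ℝ} (hc : 0 ≤ c) (hσ : ∀ i ∈ t, c ≤ σ i) (a : ι → ℝ) :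
    c * ‖∑ i ∈ t, a i • v i‖ ≤ ‖∑ i, (σ i * ⟪v i, ∑ j ∈ t, a j • v j⟫) • u i‖ := by
  refine le_of_sq_le_sq ?_ (norm_nonneg _)
  rw [hu.norm_sq_sum_smul, mul_pow, hv.norm_sq_sum_smul, Finset.mul_sum]
  calc ∑ i ∈ t, c ^ 2 * a i ^ 2
      ≤ ∑ i ∈ t, (σ i * ⟪v i, ∑ j ∈ t, a j • v j⟫) ^ 2 := by
        refine Finset.sum_le_sum fun i hi => ?_
        rw [hv.inner_right_sum a hi, mul_pow]
        gcongr
        exact hσ i hi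
    _ ≤ _ := Finset.sum_le_sum_of_subset_of_nonneg (Finset.subset_univ t)
        fun i _ _ => sq_nonneg _

/-- A matrix of rank less than `#t` kills a nontrivial combination of any vectors indexed
by `t`. -/
lemma Matrix.exists_mulVec_sum_smul_eq_zero {m n ι : Type*} [Fintype n]
    (M : Matrix m n ℝ) (t : Finset ι) (ht : M.rank < t.card) (v : ι → n → ℝ) :
    ∃ a : ι → ℝ, (∃ i ∈ t, a i ≠ 0) ∧ M *ᵥ (∑ i ∈ t, a i • v i) = 0 := by
  let w : t → LinearMap.range M.mulVecLin := fun i => M.mulVecLin.rangeRestrict (v i)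
  have hw : Module.finrank ℝ (LinearMap.range M.mulVecLin) < Fintype.card t := by
    simpa [Matrix.rank] using ht
  obtain ⟨g, hg, i, hi⟩ : ∃ g : t → ℝ, ∑ i, g i • w i = 0 ∧ ∃ i, g i ≠ 0 := by
    by_contra hcon
    have hli : LinearIndependent ℝ w := by
      rw [Fintype.linearIndependent_iff]
      intro g hg i
      by_contra hi
      exact hcon ⟨g, hg, i, hi⟩
    exact absurd hli.fintype_card_le_finrank (not_le.mpr hw)
  classical
  refine ⟨fun i => if h : i ∈ t then g ⟨i, h⟩ else 0, ⟨i, i.2, by simpa using hi⟩, ?_⟩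
  have hg' := congrArg Subtype.val hg
  rw [← Finset.sum_coe_sort t]
  simpa [w, Matrix.mulVec_sum, Matrix.mulVec_smul] using hg'

/-- Coordinate orthonormality relations give an orthonormal family in Euclidean space. -/
lemma orthonormal_toLp_of_sum_mul {ι n : Type*} [DecidableEq ι] [Fintype n] {v : ι → n → ℝ}
    (hv : ∀ i j, (∑ b, v i b * v j b) = if i = j then (1 : ℝ) else 0) :
    Orthonormal ℝ fun i => WithLp.toLp 2 (v i) := by
  rw [orthonormal_iff_ite]
  intro i j
  rw [← hv i j]
  simp [PiLp.inner_apply, mul_comm]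

/-- The action of a combination of rank-one matrices on Euclidean space. -/
lemma Matrix.toEuclideanLin_sum_smul_vecMulVec {m n ι : Type*} [Fintype n] [DecidableEq n]
    (s : Finset ι) (σ : ι → ℝ) (u : ι → m → ℝ) (v : ι → n → ℝ) (x : EuclideanSpace ℝ n) :
    Matrix.toEuclideanLin (∑ i ∈ s, σ i • Matrix.vecMulVec (u i) (v i)) x =
      ∑ i ∈ s, (σ i * ⟪WithLp.toLp 2 (v i), x⟫) • WithLp.toLp 2 (u i) := by
  ext a
  simp only [map_sum, map_smul, LinearMap.sum_apply, LinearMap.smul_apply, WithLp.ofLp_sum,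
    Finset.sum_apply, WithLp.ofLp_smul, Pi.smul_apply, smul_eq_mul]
  refine Finset.sum_congr rfl fun i _ => ?_
  have : (⟪WithLp.toLp 2 (v i), x⟫ : ℝ) = v i ⬝ᵥ x.ofLp := by
    simp [PiLp.inner_apply, dotProduct, mul_comm]
  rw [this, Matrix.toLpLin_apply, Matrix.vecMulVec_mulVec]
  simp
  ring

/-- Eckart–Young–Mirsky theorem, spectral norm version. -/
theorem eckart_young_mirsky_spectral
    {m n : ℕ} (W : Matrix (Fin m) (Fin n) ℝ)
    (σ : Fin (min m n) → ℝ)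
    (u : Fin (min m n) → Fin m → ℝ) (v : Fin (min m n) → Fin n → ℝ)
    (hu : ∀ i j, (∑ a, u i a * u j a) = if i = j then (1 : ℝ) else 0)
    (hv : ∀ i j, (∑ b, v i b * v j b) = if i = j then (1 : ℝ) else 0)
    (hσ_nonneg : ∀ i, 0 ≤ σ i)
    (hσ_mono : ∀ i j : Fin (min m n), i ≤ j → σ j ≤ σ i)
    (hW : W = ∑ i, σ i • Matrix.vecMulVec (u i) (v i))
    (k : ℕ) (hk1 : 1 ≤ k) (hk2 : k ≤ min m n)
    (Wk : Matrix (Fin m) (Fin n) ℝ)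
    (hWk : Wk = ∑ i ∈ Finset.univ.filter (fun i : Fin (min m n) => (i : ℕ) < k),
        σ i • Matrix.vecMulVec (u i) (v i))
    (M : Matrix (Fin m) (Fin n) ℝ) (hM : M.rank ≤ k) :
    spectralNorm' (W - Wk) ≤ spectralNorm' (W - M) := by
  have hu' := orthonormal_toLp_of_sum_mul hu
  have hv' := orthonormal_toLp_of_sum_mul hv
  have hdiff : W - Wk = ∑ i ∈ Finset.univ.filter (fun i : Fin (min m n) => ¬ (i : ℕ) < k),
      σ i • Matrix.vecMulVec (u i) (v i) := by
    rw [hW, hWk, sub_eq_iff_eq_add']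
    exact (Finset.sum_filter_add_sum_filter_not _ _ _).symm
  obtain rfl | hk := hk2.eq_or_lt
  · have : W - Wk = 0 := by
      rw [hdiff, Finset.filter_false_of_mem fun i _ => not_not.mpr i.isLt, Finset.sum_empty]
    rw [this]
    simp [spectralNorm']
  let κ : Fin (min m n) := ⟨k, hk⟩
  have hupper : spectralNorm' (W - Wk) ≤ σ κ := by
    refine ContinuousLinearMap.opNorm_le_bound _ (hσ_nonneg κ) fun x => ?_
    rw [LinearMap.coe_toContinuousLinearMap', hdiff, Matrix.toEuclideanLin_sum_smul_vecMulVec]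
    refine hu'.norm_sum_smul_inner_le hv' _ σ (hσ_nonneg κ) (fun i _ => hσ_nonneg i) ?_ x
    intro i hi
    exact hσ_mono κ i (not_lt.mp (Finset.mem_filter.mp hi).2)
  refine hupper.trans ?_
  have hcard : M.rank < (Finset.Iic κ).card := by
    rw [Fin.card_Iic]
    exact Nat.lt_succ_of_le hM
  obtain ⟨a, ⟨i, hi, hai⟩, ha⟩ := M.exists_mulVec_sum_smul_eq_zero _ hcard v
  set x : EuclideanSpace ℝ (Fin n) := ∑ i ∈ Finset.Iic κ, a i • WithLp.toLp 2 (v i) with hx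
  have hxpos : 0 < ‖x‖ := by
    refine norm_pos_iff.mpr fun h0 => hai ?_
    exact linearIndependent_iff'.mp hv'.linearIndependent _ a h0 i hi
  have hMx : Matrix.toEuclideanLin M x = 0 := by
    rw [Matrix.toLpLin_apply, hx, WithLp.ofLp_sum]
    simp only [WithLp.ofLp_smul, ha, WithLp.toLp_zero]
  have hlower : σ κ * ‖x‖ ≤ ‖Matrix.toEuclideanLin (W - M) x‖ := by
    rw [map_sub, LinearMap.sub_apply, hMx, sub_zero, hW,
      Matrix.toEuclideanLin_sum_smul_vecMulVec]
    exact hu'.mul_norm_le_norm_sum_smul_inner hv' _ σ (hσ_nonneg κ)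
      (fun j hj => hσ_mono j κ (Finset.mem_Iic.mp hj)) a
  exact le_of_mul_le_mul_right
    (hlower.trans (ContinuousLinearMap.le_opNorm
      (LinearMap.toContinuousLinearMap (Matrix.toEuclideanLin (W - M))) x)) hxpos
end
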